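/- (Gaussian maximizes differential entropy under a variance constraint.) Let f : ℝ → ℝ be a nonnegative Lebesgue-measurable function with ∫ f(x) dx = 1 and ∫ x²·f(x) dx ≤ σ² for some σ > 0, and assume f·log f is Lebesgue-integrable. Then −∫ f(x)·log f(x) dx ≤ (1/2)·log(2·π·e·σ²). -/

import Mathlib

open MeasureTheory Real

theorem mul_log_sub_mul_log_le {a b : ℝ} (ha : 0 ≤ a) (hb : 0 < b) :
    a * log b - a * log a ≤ b - a := by
  rcases ha.eq_or_lt with rfl | ha
  · simpa using hb.le
  · have h := mul_le_mul_of_nonneg_left (log_le_sub_one_of_pos (div_pos hb ha)) ha.le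
    rw [log_div hb.ne' ha.ne', mul_sub, mul_sub, mul_div_cancel₀ _ ha.ne', mul_one] at h
    exact h

/-- Gibbs' inequality for densities: entropy is at most cross-entropy. -/
theorem neg_integral_mul_log_le {α : Type*} [MeasurableSpace α] {μ : Measure α} {f g : α → ℝ}
    (hf0 : ∀ x, 0 ≤ f x) (hg0 : ∀ x, 0 < g x) (hf : Integrable f μ) (hg : Integrable g μ)
    (hfg : ∫ x, g x ∂μ ≤ ∫ x, f x ∂μ)
    (hff : Integrable (fun x => f x * log (f x)) μ)
    (hfl : Integrable (fun x => f x * log (g x)) μ) :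
    -∫ x, f x * log (f x) ∂μ ≤ -∫ x, f x * log (g x) ∂μ := by
  have h := integral_mono (hfl.sub hff) (hg.sub hf)
    fun x => mul_log_sub_mul_log_le (hf0 x) (hg0 x)
  rw [integral_sub' hfl hff, integral_sub' hg hf] at h
  linarith

theorem log_gaussianPDFReal (m : ℝ) {v : NNReal} (hv : v ≠ 0) (x : ℝ) :
    log (ProbabilityTheory.gaussianPDFReal m v x) =
      -(1 / 2 * log (2 * π * v)) - (x - m) ^ 2 / (2 * v) := by
  have hv' : (0 : ℝ) < v := by positivity
  have hs : 0 < 2 * π * (v : ℝ) := by positivity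
  rw [ProbabilityTheory.gaussianPDFReal, log_mul (by positivity) (exp_ne_zero _), log_exp,
    log_inv, log_sqrt hs.le]
  ring

/-- Gaussian maximizes differential entropy under a variance constraint: for a
probability density `f` on `ℝ` with second moment at most `σ²` (`σ > 0`),
`-∫ f log f ≤ (1/2) log (2πeσ²)`. -/
theorem entropy_le_gaussian {f : ℝ → ℝ} (hfm : Measurable f) (hf0 : ∀ x, 0 ≤ f x)
    (hf1 : ∫ x, f x = 1) {σ : ℝ} (hσ : 0 < σ)
    (hmom_int : Integrable (fun x => x ^ 2 * f x))
    (hmom : ∫ x, x ^ 2 * f x ≤ σ ^ 2)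
    (hent_int : Integrable (fun x => f x * Real.log (f x))) :
    -∫ x, f x * Real.log (f x) ≤
      (1 / 2) * Real.log (2 * Real.pi * Real.exp 1 * σ ^ 2) := by
  have hf : Integrable f := .of_integral_ne_zero (by simp [hf1])
  let v : NNReal := ⟨σ ^ 2, sq_nonneg σ⟩
  have hvσ : (v : ℝ) = σ ^ 2 := rfl
  have hv : v ≠ 0 := by
    rw [← NNReal.coe_ne_zero, hvσ]
    positivity
  have hlog : (fun x => f x * log (ProbabilityTheory.gaussianPDFReal 0 v x)) =
      fun x => -(1 / 2 * log (2 * π * σ ^ 2)) * f x - (2 * σ ^ 2)⁻¹ * (x ^ 2 * f x) := by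
    ext x
    rw [log_gaussianPDFReal 0 hv, hvσ]
    ring
  have hi₀ := hf.const_mul (-(1 / 2 * log (2 * π * σ ^ 2)))
  have hi₂ := hmom_int.const_mul (2 * σ ^ 2)⁻¹
  have hgibbs := neg_integral_mul_log_le hf0
    (fun x => ProbabilityTheory.gaussianPDFReal_pos 0 v x hv) hf
    (ProbabilityTheory.integrable_gaussianPDFReal 0 v)
    (by rw [hf1, ProbabilityTheory.integral_gaussianPDFReal_eq_one 0 hv]) hent_int
    (by rw [hlog]; exact hi₀.sub hi₂)
  rw [hlog, integral_sub hi₀ hi₂, integral_const_mul, integral_const_mul, hf1] at hgibbs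
  have hsecond : (2 * σ ^ 2)⁻¹ * ∫ x, x ^ 2 * f x ≤ 1 / 2 := by
    calc (2 * σ ^ 2)⁻¹ * ∫ x, x ^ 2 * f x ≤ (2 * σ ^ 2)⁻¹ * σ ^ 2 := by gcongr
      _ = 1 / 2 := by field_simp
  rw [mul_right_comm (2 * π), log_mul (by positivity) (exp_ne_zero 1), log_exp]
  linarith
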